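/- arXiv:2302.13204 — 3 statements merged into one kernel-verified Lean document; each statement's English description precedes it below -/
import Mathlib

section
/- Assume γ = t_m. Then H has exactly m distinct eigenvalues; every eigenvalue of H is real, has algebraic multiplicity exactly two and geometric multiplicity exactly one; and H possesses m pairwise orthogonal eigenvectors corresponding to these real eigenvalues. In particular H is not diagonalizable. -/
open Matrix Complex

/-- The `2m × 2m` tridiagonal Hamiltonian with diagonal entries `z 1, …, z n`
(1-based) and symmetric off-diagonal entries `t 1, …, t (n-1)`. -/
noncomputable def Hop (m : ℕ) (t : ℕ → ℝ) (z : ℕ → ℂ) :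
    Matrix (Fin (2*m)) (Fin (2*m)) ℂ :=
  fun i j =>
    if (i : ℕ) = (j : ℕ) then z ((i : ℕ) + 1)
    else if (i : ℕ) + 1 = (j : ℕ) then ((t ((i : ℕ) + 1) : ℝ) : ℂ)
    else if (j : ℕ) + 1 = (i : ℕ) then ((t ((j : ℕ) + 1) : ℝ) : ℂ)
    else 0

/-- The block matrix `M(Z) = [[1, (conj Z / t_m) P_m],[(Z / t_m) P_m, 1]]`. -/
noncomputable def Mop (m : ℕ) (t : ℕ → ℝ) (Z : ℂ) :
    Matrix (Fin (2*m)) (Fin (2*m)) ℂ :=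
  fun i j =>
    if i = j then 1
    else if (i : ℕ) + (j : ℕ) + 1 = 2*m then
      (if (i : ℕ) < m then (starRingEnd ℂ) Z / (t m : ℂ) else Z / (t m : ℂ))
    else 0

/-- General tridiagonal matrix. -/
noncomputable def Tri (n : ℕ) (t : ℕ → ℝ) (z : ℕ → ℂ) : Matrix (Fin n) (Fin n) ℂ :=
  fun i j =>
    if (i : ℕ) = (j : ℕ) then z ((i : ℕ) + 1)
    else if (i : ℕ) + 1 = (j : ℕ) then ((t ((i : ℕ) + 1) : ℝ) : ℂ)
    else if (j : ℕ) + 1 = (i : ℕ) then ((t ((j : ℕ) + 1) : ℝ) : ℂ)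
    else 0

lemma tri_zero {n : ℕ} {t : ℕ → ℝ} {z : ℕ → ℂ} (ht : ∀ j, 1 ≤ j → j + 1 ≤ n → t j ≠ 0)
    {μ : ℂ} {v : Fin n → ℂ} (hv : Tri n t z *ᵥ v = μ • v)
    (h0 : ∀ i : Fin n, (i : ℕ) = 0 → v i = 0) : v = 0 := by
  have key : ∀ k : ℕ, ∀ i : Fin n, (i : ℕ) = k → v i = 0 := by
    intro k
    induction k using Nat.strong_induction_on with
    | _ k ih =>
      intro i hi
      rcases Nat.eq_zero_or_pos k with hk | hk
      · exact h0 i (by omega)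
      · have hin := i.2
        have hr := congrFun hv ⟨k - 1, by omega⟩
        have hz : v ⟨k - 1, by omega⟩ = 0 := ih (k - 1) (by omega) _ rfl
        simp only [Pi.smul_apply, hz, smul_zero, Matrix.mulVec, dotProduct] at hr
        rw [Finset.sum_eq_single i] at hr
        · have hT : Tri n t z ⟨k - 1, by omega⟩ i = t k := by
            unfold Tri
            have e1 : ¬ (k - 1 = (i : ℕ)) := by omega
            have e2 : k - 1 + 1 = (i : ℕ) := by omega
            rw [if_neg e1, if_pos e2, e2, hi]
          rw [hT] at hr
          rcases mul_eq_zero.mp hr with h | h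
          · exact absurd (by exact_mod_cast h) (ht k hk (by omega))
          · exact h
        · intro j _ hji
          have hji' : (j : ℕ) ≠ i := fun h => hji (Fin.ext h)
          by_cases hjk : (j : ℕ) < k
          · rw [ih j hjk j rfl, mul_zero]
          · have : Tri n t z ⟨k - 1, by omega⟩ j = 0 := by
              unfold Tri
              have e1 : ¬ (k - 1 = (j : ℕ)) := by omega
              have e2 : ¬ (k - 1 + 1 = (j : ℕ)) := by omega
              have e3 : ¬ ((j : ℕ) + 1 = k - 1) := by omega
              simp only [e1, e2, e3, if_false]
            rw [this, zero_mul]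
        · intro h; exact absurd (Finset.mem_univ _) h
  funext i
  exact key i i rfl

lemma tri_dep {n : ℕ} (hn : 0 < n) {t : ℕ → ℝ} {z : ℕ → ℂ}
    (ht : ∀ j, 1 ≤ j → j + 1 ≤ n → t j ≠ 0)
    {μ : ℂ} {v w : Fin n → ℂ} (hv : Tri n t z *ᵥ v = μ • v) (hw : Tri n t z *ᵥ w = μ • w)
    (hv0 : v ≠ 0) : ∃ c : ℂ, w = c • v := by
  have h0 : v ⟨0, hn⟩ ≠ 0 := by
    intro h
    apply hv0
    refine tri_zero ht hv ?_
    intro i hi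
    have : i = ⟨0, hn⟩ := Fin.ext hi
    rw [this, h]
  refine ⟨w ⟨0, hn⟩ / v ⟨0, hn⟩, ?_⟩
  rw [← sub_eq_zero]
  refine tri_zero (μ := μ) (z := z) ht ?_ ?_
  · rw [Matrix.mulVec_sub, Matrix.mulVec_smul, hv, hw, smul_sub, smul_comm]
  · intro i hi
    have : i = ⟨0, hn⟩ := Fin.ext hi
    subst this
    simp [h0]

lemma tri_herm {n : ℕ} {t : ℕ → ℝ} {z : ℕ → ℝ} : (Tri n t (fun j => (z j : ℂ))).IsHermitian := by
  ext i j
  simp only [Matrix.conjTranspose_apply, Tri]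
  by_cases h : (i : ℕ) = j
  · simp [h]
  · have h' : ¬ (j : ℕ) = i := fun e => h e.symm
    by_cases h1 : (i : ℕ) + 1 = j
    · have h2 : ¬ (j : ℕ) + 1 = i := by omega
      simp [h, h', h1, h2]
    · by_cases h2 : (j : ℕ) + 1 = i <;> simp [h, h', h1, h2]

lemma tri_inj {n : ℕ} {t : ℕ → ℝ} {z : ℕ → ℝ} (ht : ∀ j, 1 ≤ j → j + 1 ≤ n → t j ≠ 0)
    (hA : (Tri n t (fun j => (z j : ℂ))).IsHermitian) : Function.Injective hA.eigenvalues := by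
  intro i j hij
  by_contra hne
  have hi := hA.mulVec_eigenvectorBasis i
  have hj := hA.mulVec_eigenvectorBasis j
  rw [← hij] at hj
  rw [← Complex.coe_smul] at hi hj
  have on := hA.eigenvectorBasis.orthonormal
  obtain ⟨c, hc⟩ := tri_dep (Fin.pos i) ht hi hj (by
    intro h
    apply on.ne_zero i
    ext k
    exact congrFun h k)
  have hc' : hA.eigenvectorBasis j = c • hA.eigenvectorBasis i := by
    ext k
    exact congrFun hc k
  have h1 : inner ℂ (hA.eigenvectorBasis i) (hA.eigenvectorBasis j) = 0 := on.2 hne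
  rw [hc', inner_smul_right, inner_self_eq_norm_sq_to_K, on.1 i] at h1
  simp only [RCLike.ofReal_one, one_pow, mul_one] at h1
  apply on.ne_zero j
  rw [hc', h1, zero_smul]

/-- The folding of the index set. -/
def foldE (m : ℕ) : Fin m ⊕ Fin m ≃ Fin (2 * m) where
  toFun := Sum.elim (fun i => ⟨i, by omega⟩) (fun i => ⟨2 * m - 1 - i, by omega⟩)
  invFun k := if h : (k : ℕ) < m then Sum.inl ⟨k, h⟩ else Sum.inr ⟨2 * m - 1 - k, by omega⟩
  left_inv := by
    rintro (i | i)
    · simp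
    · have h : ¬ (2 * m - 1 - (i : ℕ) < m) := by omega
      refine (dif_neg h).trans ?_
      refine congrArg Sum.inr (Fin.ext ?_)
      show 2 * m - 1 - (2 * m - 1 - (i : ℕ)) = i
      omega
  right_inv := by
    intro k
    by_cases h : (k : ℕ) < m
    · simp [h]
    · simp only [h, dite_false, Sum.elim_inr]
      ext
      simp only
      omega

/-- The corner projection. -/
def cornerE (m : ℕ) : Matrix (Fin m) (Fin m) ℂ :=
  fun i j => if (i : ℕ) + 1 = m ∧ (j : ℕ) + 1 = m then 1 else 0

lemma hop_val (m : ℕ) (t : ℕ → ℝ) (z : ℕ → ℂ) (a b : Fin (2 * m)) (p q : ℕ)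
    (hp : (a : ℕ) = p) (hq : (b : ℕ) = q) : Hop m t z a b =
    if p = q then z (p + 1)
    else if p + 1 = q then ((t (p + 1) : ℝ) : ℂ)
    else if q + 1 = p then ((t (q + 1) : ℝ) : ℂ)
    else 0 := by
  subst hp
  subst hq
  rfl

lemma fold_blocks (m : ℕ) (t : ℕ → ℝ) (z : ℕ → ℂ)
    (htsym : ∀ j, 1 ≤ j → j ≤ 2*m - 1 → t j = t (2*m - j))
    (hzreal : ∀ j, 1 ≤ j → j ≤ 2*m → j ≠ m → j ≠ m + 1 → (z j).im = 0)
    (hzsym : ∀ j, 1 ≤ j → j ≤ 2*m → z (2*m + 1 - j) = (starRingEnd ℂ) (z j))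
    (hγ_eq : (z m).im = t m) :
    (Hop m t z).submatrix (foldE m) (foldE m) =
      fromBlocks (Tri m t (fun j => ((z j).re : ℂ)) + (I * t m) • cornerE m)
        ((t m : ℂ) • cornerE m) ((t m : ℂ) • cornerE m)
        (Tri m t (fun j => ((z j).re : ℂ)) - (I * t m) • cornerE m) := by
  have hz1 : ∀ i : ℕ, i < m → z (i + 1) = ((z (i + 1)).re : ℂ) +
      (I * t m) * (if i + 1 = m then 1 else 0) := by
    intro i hi
    by_cases h : i + 1 = m
    · rw [if_pos h, h, ← hγ_eq]
      apply Complex.ext <;> simp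
    · rw [if_neg h]
      apply Complex.ext <;> simp [hzreal (i + 1) (by omega) (by omega) h (by omega)]
  have hz2 : ∀ i : ℕ, i < m → z (2 * m - 1 - i + 1) = ((z (i + 1)).re : ℂ) -
      (I * t m) * (if i + 1 = m then 1 else 0) := by
    intro i hi
    have e : 2 * m - 1 - i + 1 = 2 * m + 1 - (i + 1) := by omega
    rw [e, hzsym (i + 1) (by omega) (by omega), hz1 i hi]
    split_ifs <;> apply Complex.ext <;> simp
  ext a b
  rcases a with i | i <;> rcases b with j | j
  · have hi := i.2
    have hj := j.2
    rw [submatrix_apply, hop_val m t z _ _ (i) (j) rfl rfl]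
    simp only [fromBlocks_apply₁₁,
      Matrix.add_apply, Matrix.smul_apply, Tri, cornerE, smul_eq_mul]
    by_cases h : (i : ℕ) = j
    · rw [if_pos h, if_pos h, ← h]
      simpa only [and_self] using hz1 i hi
    · have h' : ¬ ((i : ℕ) + 1 = m ∧ (j : ℕ) + 1 = m) := by omega
      simp [h, h']
  · have hi := i.2
    have hj := j.2
    rw [submatrix_apply, hop_val m t z _ _ (i) (2 * m - 1 - j) rfl rfl]
    simp only [fromBlocks_apply₁₂, Matrix.smul_apply, cornerE, smul_eq_mul]
    have e1 : ¬ ((i : ℕ) = 2 * m - 1 - j) := by omega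
    have e2 : ¬ (2 * m - 1 - (j : ℕ) + 1 = i) := by omega
    rw [if_neg e1, if_neg e2]
    by_cases h : (i : ℕ) + 1 = m ∧ (j : ℕ) + 1 = m
    · rw [if_pos h, if_pos (by omega), h.1, mul_one]
    · rw [if_neg h, if_neg (by omega), mul_zero]
  · have hi := i.2
    have hj := j.2
    rw [submatrix_apply, hop_val m t z _ _ (2 * m - 1 - i) (j) rfl rfl]
    simp only [fromBlocks_apply₂₁, Matrix.smul_apply, cornerE, smul_eq_mul]
    have e1 : ¬ (2 * m - 1 - (i : ℕ) = j) := by omega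
    have e2 : ¬ (2 * m - 1 - (i : ℕ) + 1 = j) := by omega
    rw [if_neg e1, if_neg e2]
    by_cases h : (i : ℕ) + 1 = m ∧ (j : ℕ) + 1 = m
    · rw [if_pos h, if_pos (by omega), h.2, mul_one]
    · rw [if_neg h, if_neg (by omega), mul_zero]
  · have hi := i.2
    have hj := j.2
    rw [submatrix_apply, hop_val m t z _ _ (2 * m - 1 - i) (2 * m - 1 - j) rfl rfl]
    simp only [fromBlocks_apply₂₂,
      Matrix.sub_apply, Matrix.smul_apply, Tri, cornerE, smul_eq_mul]
    by_cases h : (i : ℕ) = j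
    · rw [if_pos (by omega), if_pos h, hz2 i hi, ← h]
      simp only [and_self]
    · have h' : ¬ ((i : ℕ) + 1 = m ∧ (j : ℕ) + 1 = m) := by omega
      rw [if_neg (by omega), if_neg h, if_neg h', mul_zero, sub_zero]
      by_cases h1 : (i : ℕ) + 1 = j
      · rw [if_neg (by omega), if_pos (by omega), if_pos h1, htsym (i + 1) (by omega) (by omega)]
        congr 2
        omega
      · by_cases h2 : (j : ℕ) + 1 = i
        · rw [if_pos (by omega), if_neg h1, if_pos h2, htsym (j + 1) (by omega) (by omega)]
          congr 2
          omega
        · rw [if_neg (by omega), if_neg (by omega), if_neg h1, if_neg h2]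

lemma block_charpoly {m : ℕ} (A E : Matrix (Fin m) (Fin m) ℂ) (g : ℂ) :
    (fromBlocks (A + (I * g) • E) (g • E) (g • E) (A - (I * g) • E)).charpoly =
      A.charpoly ^ 2 := by
  have hI : I * I = -1 := Complex.I_mul_I
  have h1 : (fromBlocks (A + (I * g) • E) (g • E) (g • E) (A - (I * g) • E)) =
      fromBlocks 1 0 (-I • (1 : Matrix (Fin m) (Fin m) ℂ)) 1 *
        (fromBlocks A (g • E) 0 A * fromBlocks 1 0 (I • (1 : Matrix (Fin m) (Fin m) ℂ)) 1) := by
    simp only [fromBlocks_multiply]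
    congr 1
    · simp [smul_smul]
    · simp
    · simp [smul_smul]
      rw [← mul_assoc, hI]
      simp
    · simp [smul_smul, mul_comm I g]
      abel
  have h2 : (fromBlocks 1 0 (I • (1 : Matrix (Fin m) (Fin m) ℂ)) 1 :
        Matrix (Fin m ⊕ Fin m) (Fin m ⊕ Fin m) ℂ) *
      fromBlocks 1 0 (-I • (1 : Matrix (Fin m) (Fin m) ℂ)) 1 = 1 := by
    simp [fromBlocks_multiply]
  rw [h1, Matrix.charpoly_mul_comm, mul_assoc, h2, mul_one, charpoly_fromBlocks_zero₂₁, sq]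

theorem stmt10 (m : ℕ) (hm : 1 ≤ m) (t : ℕ → ℝ) (z : ℕ → ℂ)
    (ht0 : ∀ j, 1 ≤ j → j ≤ 2*m - 1 → t j ≠ 0)
    (htsym : ∀ j, 1 ≤ j → j ≤ 2*m - 1 → t j = t (2*m - j))
    (htm : 0 < t m)
    (hzreal : ∀ j, 1 ≤ j → j ≤ 2*m → j ≠ m → j ≠ m + 1 → (z j).im = 0)
    (hzsym : ∀ j, 1 ≤ j → j ≤ 2*m → z (2*m + 1 - j) = (starRingEnd ℂ) (z j))
    (hγ : 0 ≤ (z m).im)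
    (hγ_eq : (z m).im = t m) :
    (spectrum ℂ (Hop m t z)).ncard = m ∧
    (∀ μ ∈ spectrum ℂ (Hop m t z),
      μ.im = 0 ∧
      (Hop m t z).charpoly.rootMultiplicity μ = 2 ∧
      Module.finrank ℂ
        (LinearMap.ker (Matrix.toLin' (Hop m t z - μ • (1 : Matrix (Fin (2*m)) (Fin (2*m)) ℂ)))) = 1) ∧
    (∃ v : Fin m → (Fin (2*m) → ℂ),
      (∀ i, v i ≠ 0) ∧
      (∀ i j, i ≠ j → star (v i) ⬝ᵥ v j = 0) ∧
      (∀ i, ∃ μ : ℝ, ((μ : ℂ) ∈ spectrum ℂ (Hop m t z) ∧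
        (Hop m t z).mulVec (v i) = (μ : ℂ) • v i))) ∧
    ¬ (∃ P : Matrix (Fin (2*m)) (Fin (2*m)) ℂ,
        IsUnit P.det ∧ (P⁻¹ * Hop m t z * P).IsDiag) := by
  classical
  have hTri : Hop m t z = Tri (2 * m) t z := rfl
  set A := Tri m t (fun j => ((z j).re : ℂ)) with hAdef
  have hA : A.IsHermitian := tri_herm
  have htA : ∀ j, 1 ≤ j → j + 1 ≤ m → t j ≠ 0 := fun j h1 h2 => ht0 j h1 (by omega)
  have htH : ∀ j, 1 ≤ j → j + 1 ≤ 2 * m → t j ≠ 0 := fun j h1 h2 => ht0 j h1 (by omega)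
  have hinj : Function.Injective hA.eigenvalues := tri_inj htA hA
  have hfold := fold_blocks m t z htsym hzreal hzsym hγ_eq
  rw [← hAdef] at hfold
  have hchar : (Hop m t z).charpoly = A.charpoly ^ 2 := by
    rw [← block_charpoly A (cornerE m) (t m), ← hfold]
    exact (Matrix.charpoly_reindex (foldE m).symm (Hop m t z)).symm
  have hinjC : Function.Injective (fun i => ((hA.eigenvalues i : ℝ) : ℂ)) :=
    Complex.ofReal_injective.comp hinj
  have hspec : spectrum ℂ (Hop m t z) = Set.range (fun i => ((hA.eigenvalues i : ℝ) : ℂ)) := by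
    ext μ
    rw [Matrix.mem_spectrum_iff_isRoot_charpoly, hchar, hA.charpoly_eq, Polynomial.IsRoot.def,
      Polynomial.eval_pow, Polynomial.eval_prod]
    simp only [ne_eq, OfNat.ofNat_ne_zero, not_false_eq_true, pow_eq_zero_iff,
      Finset.prod_eq_zero_iff, Finset.mem_univ, true_and, Polynomial.eval_sub, Polynomial.eval_X,
      Polynomial.eval_C, sub_eq_zero, Set.mem_range]
    exact exists_congr fun i => eq_comm
  have hncard : (spectrum ℂ (Hop m t z)).ncard = m := by
    rw [hspec, ← Set.image_univ, Set.ncard_image_of_injective _ hinjC]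
    simp
  refine ⟨hncard, ?_, ?_, ?_⟩
  · intro μ hμ
    obtain ⟨i, rfl⟩ := hspec ▸ hμ
    refine ⟨by simp, ?_, ?_⟩
    · rw [← Polynomial.count_roots, hchar, Polynomial.roots_pow, hA.roots_charpoly_eq_eigenvalues,
        Multiset.count_nsmul]
      have := Multiset.count_map_eq_count' (RCLike.ofReal ∘ hA.eigenvalues : Fin m → ℂ)
        Finset.univ.val hinjC i
      simp only [Function.comp_apply, Complex.coe_algebraMap] at this ⊢
      erw [this]
      simp
    · have hmem : ∀ w, w ∈ LinearMap.ker (Matrix.toLin' (Hop m t z -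
          ((hA.eigenvalues i : ℝ) : ℂ) • (1 : Matrix (Fin (2*m)) (Fin (2*m)) ℂ))) ↔
          Tri (2 * m) t z *ᵥ w = ((hA.eigenvalues i : ℝ) : ℂ) • w := by
        intro w
        rw [LinearMap.mem_ker, Matrix.toLin'_apply, Matrix.sub_mulVec, Matrix.smul_mulVec,
          Matrix.one_mulVec, sub_eq_zero, hTri]
      have hdet : (Hop m t z -
          ((hA.eigenvalues i : ℝ) : ℂ) • (1 : Matrix (Fin (2*m)) (Fin (2*m)) ℂ)).det = 0 := by
        by_contra h
        rw [spectrum.mem_iff, Algebra.algebraMap_eq_smul_one] at hμ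
        apply hμ
        rw [← neg_sub, IsUnit.neg_iff, Matrix.isUnit_iff_isUnit_det]
        exact isUnit_iff_ne_zero.mpr h
      obtain ⟨v, hv0, hv⟩ := Matrix.exists_mulVec_eq_zero_iff.mpr hdet
      have hvm : v ∈ LinearMap.ker (Matrix.toLin' (Hop m t z -
          ((hA.eigenvalues i : ℝ) : ℂ) • (1 : Matrix (Fin (2*m)) (Fin (2*m)) ℂ))) := by
        rw [LinearMap.mem_ker, Matrix.toLin'_apply, hv]
      refine finrank_eq_one ⟨v, hvm⟩ (fun h => hv0 (congrArg Subtype.val h)) ?_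
      rintro ⟨w, hw⟩
      obtain ⟨c, hc⟩ := tri_dep (by omega) htH ((hmem v).1 hvm) ((hmem w).1 hw) hv0
      exact ⟨c, Subtype.ext hc.symm⟩
  · let x : Fin m → Fin m → ℂ := fun i => ⇑(hA.eigenvectorBasis i)
    have hx : ∀ i, A *ᵥ x i = ((hA.eigenvalues i : ℝ) : ℂ) • x i := by
      intro i
      rw [Complex.coe_smul]
      exact hA.mulVec_eigenvectorBasis i
    let u : Fin m → Fin m ⊕ Fin m → ℂ := fun i => Sum.elim (x i) (-I • x i)
    have hu : ∀ i, (Hop m t z).submatrix (foldE m) (foldE m) *ᵥ u i =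
        ((hA.eigenvalues i : ℝ) : ℂ) • u i := by
      intro i
      rw [hfold]
      simp only [u, Matrix.fromBlocks_mulVec, Sum.elim_comp_inl, Sum.elim_comp_inr,
        Matrix.add_mulVec, Matrix.sub_mulVec, Matrix.smul_mulVec, Matrix.mulVec_smul, hx]
      ext k
      rcases k with k | k
      · simp
        ring
      · simp
        linear_combination ((t m : ℂ) * (cornerE m *ᵥ x i) k) * Complex.I_mul_I
    have on := hA.eigenvectorBasis.orthonormal
    refine ⟨fun i => u i ∘ (foldE m).symm, ?_, ?_, ?_⟩
    · intro i h
      apply on.ne_zero i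
      ext k
      have := congrFun h (foldE m (Sum.inl k))
      simpa [u, x] using this
    · intro i j hij
      have h1 : inner ℂ (hA.eigenvectorBasis i) (hA.eigenvectorBasis j) = 0 := on.2 hij
      rw [EuclideanSpace.inner_eq_star_dotProduct, dotProduct_comm] at h1
      have h2 : star (x i) ⬝ᵥ x j = 0 := h1
      have h3 : star (u i ∘ (foldE m).symm) ⬝ᵥ (u j ∘ (foldE m).symm) = star (u i) ⬝ᵥ u j := by
        simp only [dotProduct]
        exact Equiv.sum_comp (foldE m).symm (fun k => star (u i) k * u j k)
      rw [h3]
      simp only [dotProduct, Fintype.sum_sum_type, u, Pi.star_apply, Sum.elim_inl, Sum.elim_inr,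
        Pi.smul_apply, smul_eq_mul] at h2 ⊢
      rw [h2, zero_add]
      have h4 : ∀ k, star (-I * x i k) * (-I * x j k) = star (x i k) * x j k := by
        intro k
        simp
        linear_combination (-(starRingEnd ℂ) (x i k) * x j k) * Complex.I_mul_I
      simp only [h4, h2]
    · intro i
      refine ⟨hA.eigenvalues i, hspec ▸ ⟨i, rfl⟩, ?_⟩
      have := hu i
      rw [Matrix.submatrix_mulVec_equiv] at this
      ext k
      have := congrFun this ((foldE m).symm k)
      simpa using this
  · rintro ⟨P, hP, hD⟩
    set D := P⁻¹ * Hop m t z * P with hDdef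
    have hPD : Hop m t z * P = P * D := by
      rw [hDdef, ← mul_assoc, ← mul_assoc, Matrix.mul_nonsing_inv _ hP, one_mul]
    have hcol : ∀ j, Tri (2 * m) t z *ᵥ (fun i => P i j) = D j j • (fun i => P i j) := by
      intro j
      ext i
      have h := congrFun (congrFun hPD i) j
      rw [Matrix.mul_apply, Matrix.mul_apply, Finset.sum_eq_single (f := fun k => P i k * D k j) j] at h
      · simp only [Pi.smul_apply, smul_eq_mul, Matrix.mulVec, dotProduct, ← hTri]
        rw [h, mul_comm]
      · intro k _ hk
        rw [hD hk, mul_zero]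
      · intro h; exact absurd (Finset.mem_univ _) h
    have hne : ∀ j, (fun i => P i j) ≠ 0 := by
      intro j h
      rw [Matrix.det_eq_zero_of_column_eq_zero j (fun i => congrFun h i)] at hP
      exact not_isUnit_zero hP
    have hin : ∀ j, D j j ∈ spectrum ℂ (Hop m t z) := by
      intro j
      rw [spectrum.mem_iff, Algebra.algebraMap_eq_smul_one, Matrix.isUnit_iff_isUnit_det,
        isUnit_iff_ne_zero, not_not, ← Matrix.exists_mulVec_eq_zero_iff]
      refine ⟨_, hne j, ?_⟩
      rw [Matrix.sub_mulVec, Matrix.smul_mulVec, Matrix.one_mulVec, hTri, hcol, sub_self]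
    rw [hspec] at hin
    choose f hf using hin
    obtain ⟨a, b, hab, hfab⟩ := Fintype.exists_ne_map_eq_of_card_lt f (by simp; omega)
    have hDab : D b b = D a a := by rw [← hf a, ← hf b, hfab]
    have hb := hcol b
    rw [hDab] at hb
    obtain ⟨c, hc⟩ := tri_dep (by omega) htH (hcol a) hb (hne a)
    have hdet : P.det = 0 := by
      rw [← Matrix.exists_mulVec_eq_zero_iff]
      refine ⟨Pi.single b 1 - c • Pi.single a 1, ?_, ?_⟩
      · intro h
        have := congrFun h b
        simp [hab.symm] at this
      · rw [Matrix.mulVec_sub, Matrix.mulVec_smul, Matrix.mulVec_single_one,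
          Matrix.mulVec_single_one, sub_eq_zero]
        exact hc
    rw [hdet] at hP
    exact not_isUnit_zero hP
end

section
/- Suppose n = 2k + 1 with k ≥ 1. Then for all λ ∈ ℂ, (t_1 t_2)^{−k}·det(λ·1_n − H) = (λ − z_1 − z_n)·U_k(Q) − (t_L + t_R) + ((λ(z_1 z_n − t_L t_R) − z_1 t_1² − z_n t_2²)/(t_1 t_2))·U_{k−1}(Q). -/
open Matrix Complex Polynomial

/-- The `n`-site SSH chain with alternating hoppings `t1` (odd bonds) and `t2`
(even bonds), defect potentials `z1`, `zn` at the two ends, and corner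
entries `tL` (top-right) and `tR` (bottom-left). -/
noncomputable def Hssh (n : ℕ) (t1 t2 : ℝ) (z1 zn tL tR : ℂ) :
    Matrix (Fin n) (Fin n) ℂ :=
  fun i j =>
    if (i : ℕ) = (j : ℕ) then
      (if (i : ℕ) = 0 then z1 else if (i : ℕ) = n - 1 then zn else 0)
    else if (i : ℕ) + 1 = (j : ℕ) then
      (if (i : ℕ) % 2 = 0 then (t1 : ℂ) else (t2 : ℂ))
    else if (j : ℕ) + 1 = (i : ℕ) then
      (if (j : ℕ) % 2 = 0 then (t1 : ℂ) else (t2 : ℂ))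
    else if (i : ℕ) = 0 ∧ (j : ℕ) = n - 1 then tL
    else if (i : ℕ) = n - 1 ∧ (j : ℕ) = 0 then tR
    else 0

namespace SSHaux

/-- The bond strength to the right of site `j`. -/
noncomputable def bond (t1 t2 : ℂ) (j : ℕ) : ℂ := if j % 2 = 0 then t1 else t2

/-- Rows of `lam - H`, cyclically rotated so that the last row comes first (`n = 2p+3`). -/
noncomputable def rot (p : ℕ) (t1 t2 z1 zn tL tR lam : ℂ) : ℕ → ℕ → ℂ
  | 0, j => (if j = 0 then -tR else 0) + (if j = 2*p+1 then -t2 else 0)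
      + (if j = 2*p+2 then lam - zn else 0)
  | 1, j => (if j = 0 then lam - z1 else 0) + (if j = 1 then -t1 else 0)
      + (if j = 2*p+2 then -tL else 0)
  | (i+2), j => (if j = i then -bond t1 t2 i else 0) + (if j = i+1 then lam else 0)
      + (if j = i+2 then -bond t1 t2 (i+1) else 0)

/-- The rotated matrix. -/
noncomputable def rotM (p : ℕ) (t1 t2 z1 zn tL tR lam : ℂ) :
    Matrix (Fin (2*p+3)) (Fin (2*p+3)) ℂ :=
  Matrix.of fun i j => rot p t1 t2 z1 zn tL tR lam i j

/-- Transfer matrix: the first two columns are solutions of the bulk recurrence. -/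
noncomputable def trV (p : ℕ) (u v : ℕ → ℂ) : Matrix (Fin (2*p+3)) (Fin (2*p+3)) ℂ :=
  Matrix.of fun j c => if (c : ℕ) = 0 then u j else if (c : ℕ) = 1 then v j else
    if j = c then 1 else 0

lemma det_rot (p : ℕ) (t1 t2 : ℝ) (z1 zn tL tR lam : ℂ) :
    Matrix.det (lam • (1 : Matrix (Fin (2*p+3)) (Fin (2*p+3)) ℂ)
      - Hssh (2*p+3) t1 t2 z1 zn tL tR) = (rotM p t1 t2 z1 zn tL tR lam).det := by
  have h : (lam • (1 : Matrix (Fin (2*p+3)) (Fin (2*p+3)) ℂ)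
      - Hssh (2*p+3) t1 t2 z1 zn tL tR)
      = (rotM p t1 t2 z1 zn tL tR lam).submatrix (finRotate (2*p+2+1)) id := by
    ext i j
    obtain ⟨i, hi⟩ := i
    obtain ⟨j, hj⟩ := j
    simp only [Matrix.sub_apply, Matrix.smul_apply, Matrix.one_apply, Matrix.submatrix_apply,
      rotM, Matrix.of_apply, Hssh, id, smul_eq_mul, Fin.mk.injEq]
    by_cases hl : i = 2*p+2
    · subst hl
      have : finRotate (2*p+2+1) ⟨2*p+2, hi⟩ = 0 := finRotate_last
      rw [this]
      simp only [Fin.val_zero, rot]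
      split_ifs <;> first | contradiction | omega | (exfalso; simp only [true_and, false_and, not_true, not_false_iff] at * <;> omega) | simp
    · have : finRotate (2*p+2+1) ⟨i, hi⟩ = ⟨i+1, by omega⟩ := finRotate_of_lt (by omega)
      rw [this]
      rcases i with _ | i
      · simp only [rot]
        split_ifs <;> first | contradiction | omega | (exfalso; simp only [true_and, false_and, not_true, not_false_iff] at * <;> omega) | simp
      · simp only [rot, bond]
        split_ifs <;> first | contradiction | omega | (exfalso; simp only [true_and, false_and, not_true, not_false_iff] at * <;> omega) | simp
  rw [h, Matrix.det_permute, sign_finRotate]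
  simp [pow_add, pow_mul]

lemma det_trV (p : ℕ) (u v : ℕ → ℂ) (hu : u 0 = 1) (hv0 : v 0 = 0) (hv : v 1 = 1) :
    (trV p u v).det = 1 := by
  rw [Matrix.det_of_lowerTriangular]
  · apply Finset.prod_eq_one
    rintro ⟨i, hi⟩ -
    simp only [trV, Matrix.of_apply]
    split_ifs with h1 h2
    · rw [h1, hu]
    · rw [h2, hv]
    · rfl
  · rintro ⟨i, hi⟩ ⟨j, hj⟩ hij
    have hij : i < j := by simpa using hij
    simp only [trV, Matrix.of_apply, Fin.mk.injEq]
    split_ifs with h1 h2 h3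
    · omega
    · have : i = 0 := by omega
      rw [this, hv0]
    · omega
    · rfl

lemma mul_col (p : ℕ) (t1 t2 z1 zn tL tR lam : ℂ) (w : ℕ → ℂ) (i : Fin (2*p+3)) :
    ∑ j : Fin (2*p+3), rotM p t1 t2 z1 zn tL tR lam i j * w j
      = match (i : ℕ) with
        | 0 => -tR * w 0 - t2 * w (2*p+1) + (lam - zn) * w (2*p+2)
        | 1 => (lam - z1) * w 0 - t1 * w 1 - tL * w (2*p+2)
        | (i+2) => -bond t1 t2 i * w i + lam * w (i+1) - bond t1 t2 (i+1) * w (i+2) := by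
  obtain ⟨i, hi⟩ := i
  simp only [rotM, Matrix.of_apply]
  rw [Fin.sum_univ_eq_sum_range (fun j => rot p t1 t2 z1 zn tL tR lam i j * w j)]
  rcases i with _ | _ | i
  · simp [rot, add_mul, Finset.sum_add_distrib, ite_mul, Finset.sum_ite_eq']
    ring
  · simp [rot, add_mul, Finset.sum_add_distrib, ite_mul, Finset.sum_ite_eq']
    ring
  · have h1 : i < 2*p+3 := by omega
    have h2 : i+1 < 2*p+3 := by omega
    simp [rot, add_mul, Finset.sum_add_distrib, ite_mul, Finset.sum_ite_eq', h1, h2, hi]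
    ring

lemma det_main (p : ℕ) (t1 t2 z1 zn tL tR lam : ℂ) (u v : ℕ → ℂ)
    (hu : u 0 = 1) (hu1 : u 1 = 0) (hv0 : v 0 = 0) (hv : v 1 = 1)
    (ru : ∀ i, -bond t1 t2 i * u i + lam * u (i+1) - bond t1 t2 (i+1) * u (i+2) = 0)
    (rv : ∀ i, -bond t1 t2 i * v i + lam * v (i+1) - bond t1 t2 (i+1) * v (i+2) = 0) :
    (rotM p t1 t2 z1 zn tL tR lam).det =
      ((-tR - t2 * u (2*p+1) + (lam - zn) * u (2*p+2)) * (-t1 - tL * v (2*p+2))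
        - (- t2 * v (2*p+1) + (lam - zn) * v (2*p+2)) * (lam - z1 - tL * u (2*p+2)))
      * ∏ i : Fin (2*p+1), (-bond t1 t2 (i+1)) := by
  have h1 : (rotM p t1 t2 z1 zn tL tR lam).det
      = (rotM p t1 t2 z1 zn tL tR lam * trV p u v).det := by
    rw [Matrix.det_mul, det_trV p u v hu hv0 hv, mul_one]
  set N := rotM p t1 t2 z1 zn tL tR lam * trV p u v with hN
  have c0 : ∀ i c : Fin (2*p+3), (c : ℕ) = 0 →
      N i c = ∑ j : Fin (2*p+3), rotM p t1 t2 z1 zn tL tR lam i j * u j := by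
    intro i c hc
    simp only [hN, Matrix.mul_apply, trV, Matrix.of_apply, hc]
    simp
  have c1 : ∀ i c : Fin (2*p+3), (c : ℕ) = 1 →
      N i c = ∑ j : Fin (2*p+3), rotM p t1 t2 z1 zn tL tR lam i j * v j := by
    intro i c hc
    simp only [hN, Matrix.mul_apply, trV, Matrix.of_apply, hc]
    simp
  have c2 : ∀ i c : Fin (2*p+3), 2 ≤ (c : ℕ) →
      N i c = rotM p t1 t2 z1 zn tL tR lam i c := by
    intro i c hc
    have h0 : (c : ℕ) ≠ 0 := by omega
    have h1 : (c : ℕ) ≠ 1 := by omega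
    simp only [hN, Matrix.mul_apply, trV, Matrix.of_apply, h0, h1, if_false]
    simp
  let e : Fin 2 ⊕ Fin (2*p+1) ≃ Fin (2*p+3) :=
    finSumFinEquiv.trans (finCongr (by omega))
  have el : ∀ a, ((e (Sum.inl a) : Fin (2*p+3)) : ℕ) = a := by intro a; simp [e]
  have er : ∀ a, ((e (Sum.inr a) : Fin (2*p+3)) : ℕ) = a + 2 := by
    intro a; simp [e]
  rw [h1, ← Matrix.det_submatrix_equiv_self e N, ← Matrix.fromBlocks_toBlocks (N.submatrix e e)]
  have hz : (N.submatrix e e).toBlocks₂₁ = 0 := by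
    ext i c
    simp only [Matrix.toBlocks₂₁, Matrix.of_apply, Matrix.submatrix_apply, Matrix.zero_apply]
    fin_cases c
    · rw [c0 _ _ (by rw [el]), mul_col, er]
      exact ru _
    · rw [c1 _ _ (by rw [el]), mul_col, er]
      exact rv _
  rw [hz, Matrix.det_fromBlocks_zero₂₁]
  congr 1
  · rw [Matrix.det_fin_two]
    simp only [Matrix.toBlocks₁₁, Matrix.of_apply, Matrix.submatrix_apply]
    rw [c0 _ (e (Sum.inl 0)) (by rw [el]; rfl), c1 _ (e (Sum.inl 1)) (by rw [el]; rfl),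
      c0 _ (e (Sum.inl 0)) (by rw [el]; rfl), c1 _ (e (Sum.inl 1)) (by rw [el]; rfl), mul_col, mul_col, mul_col, mul_col, el, el]
    simp only [Fin.val_zero, Fin.val_one, hu, hu1, hv0, hv]
    ring
  · rw [Matrix.det_of_lowerTriangular]
    · refine Finset.prod_congr rfl fun i _ => ?_
      simp only [Matrix.toBlocks₂₂, Matrix.of_apply, Matrix.submatrix_apply]
      rw [c2 _ _ (by rw [er]; omega)]
      simp [rotM, er, rot]
    · intro i j hij
      have hij : (i : ℕ) < j := by simpa using hij
      simp only [Matrix.toBlocks₂₂, Matrix.of_apply, Matrix.submatrix_apply]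
      rw [c2 _ _ (by rw [er]; omega)]
      simp only [rotM, er, rot, Matrix.of_apply]
      split_ifs <;> first | contradiction | omega | simp

lemma prod_bond (p : ℕ) (t1 t2 : ℂ) :
    ∏ i : Fin (2*p+1), (-bond t1 t2 (i+1)) = -(t2 * (t1*t2)^p) := by
  rw [Fin.prod_univ_eq_prod_range (fun i => -bond t1 t2 (i+1))]
  induction p with
  | zero => simp [bond]
  | succ p ih =>
    rw [show 2*(p+1)+1 = 2*p+1+1+1 by ring, Finset.prod_range_succ, Finset.prod_range_succ, ih]
    have a1 : (2*p+1+1) % 2 = 0 := by omega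
    have a2 : ¬ (2*p+1+1+1) % 2 = 0 := by omega
    simp only [bond, a1, a2, if_true, if_false]
    ring

end SSHaux

theorem stmt15 (n k : ℕ) (t1 t2 : ℝ) (ht1 : t1 ≠ 0) (ht2 : t2 ≠ 0)
    (z1 zn tL tR : ℂ) (hk : 1 ≤ k) (hnk : n = 2*k + 1) :
    ∀ lam : ℂ,
      (((t1 * t2 : ℝ) : ℂ))^(-(k : ℤ)) *
          Matrix.det (lam • (1 : Matrix (Fin n) (Fin n) ℂ) - Hssh n t1 t2 z1 zn tL tR) =
        (lam - z1 - zn) *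
            (Chebyshev.U ℂ (k : ℤ)).eval ((lam^2 - (t1 : ℂ)^2 - (t2 : ℂ)^2) / (2 * t1 * t2))
          - (tL + tR)
          + ((lam * (z1 * zn - tL * tR) - z1 * (t1 : ℂ)^2 - zn * (t2 : ℂ)^2) / ((t1 : ℂ) * t2)) *
              (Chebyshev.U ℂ ((k : ℤ) - 1)).eval ((lam^2 - (t1 : ℂ)^2 - (t2 : ℂ)^2) / (2 * t1 * t2)) := by
  intro lam
  obtain ⟨p, rfl⟩ : ∃ p, k = p + 1 := ⟨k - 1, by omega⟩
  obtain rfl : n = 2*p+3 := by omega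
  rw [SSHaux.det_rot]
  push_cast
  have h1 : (t1 : ℂ) ≠ 0 := by exact_mod_cast ht1
  have h2 : (t2 : ℂ) ≠ 0 := by exact_mod_cast ht2
  generalize (t1 : ℂ) = a at *
  generalize (t2 : ℂ) = b at *
  set Q : ℂ := (lam^2 - a^2 - b^2) / (2 * a * b) with hQ
  have hlam : lam^2 = a^2 + b^2 + 2 * a * b * Q := by
    rw [hQ]; field_simp; ring
  let U : ℤ → ℂ := fun m => (Chebyshev.U ℂ m).eval Q
  have rU : ∀ m : ℤ, U (m + 1) = 2 * Q * U m - U (m - 1) := by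
    intro m
    simp only [U]
    rw [Chebyshev.U_add_one]
    simp
  have U0 : U 0 = 1 := by simp [U]
  have Um1 : U (-1) = 0 := by simp [U]
  have Um2 : U (-2) = -1 := by simp [U]
  let u : ℕ → ℂ := fun j => if j % 2 = 0 then -(U (((j/2 : ℕ) : ℤ) - 1) * a / b + U (((j/2 : ℕ) : ℤ) - 2))
    else -(lam / b) * U (((j/2 : ℕ) : ℤ) - 1)
  let v : ℕ → ℂ := fun j => if j % 2 = 0 then (lam / b) * U (((j/2 : ℕ) : ℤ) - 1)
    else U ((j/2 : ℕ) : ℤ) + a / b * U (((j/2 : ℕ) : ℤ) - 1)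
  have ue : ∀ m : ℕ, u (2*m) = -(U ((m : ℤ) - 1) * a / b + U ((m : ℤ) - 2)) := by
    intro m
    have e1 : (2*m) % 2 = 0 := by omega
    have e2 : (2*m) / 2 = m := by omega
    simp only [u, e1, e2, if_true]
  have uo : ∀ m : ℕ, u (2*m+1) = -(lam / b) * U ((m : ℤ) - 1) := by
    intro m
    have e1 : ¬ (2*m+1) % 2 = 0 := by omega
    have e2 : (2*m+1) / 2 = m := by omega
    simp only [u, e1, e2, if_false]
  have ve : ∀ m : ℕ, v (2*m) = (lam / b) * U ((m : ℤ) - 1) := by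
    intro m
    have e1 : (2*m) % 2 = 0 := by omega
    have e2 : (2*m) / 2 = m := by omega
    simp only [v, e1, e2, if_true]
  have vo : ∀ m : ℕ, v (2*m+1) = U (m : ℤ) + a / b * U ((m : ℤ) - 1) := by
    intro m
    have e1 : ¬ (2*m+1) % 2 = 0 := by omega
    have e2 : (2*m+1) / 2 = m := by omega
    simp only [v, e1, e2, if_false]
  clear_value u v Q
  have be : ∀ m : ℕ, SSHaux.bond a b (2*m) = a := by
    intro m
    simp [SSHaux.bond]
  have bo : ∀ m : ℕ, SSHaux.bond a b (2*m+1) = b := by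
    intro m
    have e1 : ¬ (2*m+1) % 2 = 0 := by omega
    simp only [SSHaux.bond, e1, if_false]
  have rm1 : ∀ m : ℤ, U m = 2 * Q * U (m - 1) - U (m - 2) := by
    intro m
    have := rU (m - 1)
    rwa [show m - 1 + 1 = m by ring, show m - 1 - 1 = m - 2 by ring] at this
  have key : ∀ w : ℕ → ℂ, (∀ m : ℕ, -a * w (2*m) + lam * w (2*m+1) - b * w (2*(m+1)) = 0) →
      (∀ m : ℕ, -b * w (2*m+1) + lam * w (2*(m+1)) - a * w (2*(m+1)+1) = 0) →
      ∀ i, -SSHaux.bond a b i * w i + lam * w (i+1) - SSHaux.bond a b (i+1) * w (i+2) = 0 := by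
    intro w hw1 hw2 i
    obtain ⟨m, rfl | rfl⟩ : ∃ m, i = 2*m ∨ i = 2*m+1 := ⟨i/2, by omega⟩
    · rw [be, bo]; exact hw1 m
    · rw [bo, show 2*m+1+1 = 2*(m+1) by ring, be]; exact hw2 m
  have sh : ∀ m : ℕ, (((m+1 : ℕ) : ℤ) - 1 = m) ∧ (((m+1 : ℕ) : ℤ) - 2 = m - 1)
      ∧ (((m+1 : ℕ) : ℤ) = m + 1) := by
    intro m; push_cast; refine ⟨by ring, by ring, by ring⟩
  have ru := key u
    (by
      intro m
      rw [ue, uo, ue, (sh m).1, (sh m).2.1, rm1 m]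
      field_simp
      linear_combination (-U ((m : ℤ) - 1)) * hlam)
    (by
      intro m
      rw [uo, ue, uo, (sh m).1, (sh m).2.1]
      field_simp
      ring)
  have rv := key v
    (by
      intro m
      rw [ve, vo, ve, (sh m).1]
      field_simp
      ring)
    (by
      intro m
      rw [ve, vo, vo, (sh m).1, (sh m).2.2, rU]
      field_simp
      linear_combination (U (m : ℤ)) * hlam)
  have wr : ∀ m : ℕ, U (m : ℤ) ^ 2 - U ((m : ℤ) + 1) * U ((m : ℤ) - 1) = 1 := by
    intro m
    induction m with
    | zero => simp [U0, Um1]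
    | succ m ih =>
      rw [(sh m).1, (sh m).2.2, rU ((m : ℤ) + 1), show (m : ℤ) + 1 - 1 = m by ring]
      rw [rU] at ih ⊢
      linear_combination ih
  rw [SSHaux.det_main p a b z1 zn tL tR lam u v
    (by have := ue 0; simpa [Um1, Um2] using this) (by have := uo 0; simpa [Um1] using this)
    (by have := ve 0; simpa [Um1] using this) (by have := vo 0; simpa [Um1, U0] using this)
    ru rv, SSHaux.prod_bond]
  have hw := wr p
  rw [show 2*p+2 = 2*(p+1) by ring, ue, uo, ve, vo, (sh p).1, (sh p).2.1]
  rw [show ((p : ℤ) + 1 - 1) = p by ring]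
  change _ = (lam - z1 - zn) * U ((p : ℤ) + 1) - (tL + tR) + _ * U (p : ℤ)
  rw [rU] at hw ⊢
  have hab : (a * b) ^ (-((p : ℤ) + 1)) * (-(b * (a * b)^p)) = - (1 / a) := by
    rw [_root_.zpow_neg, zpow_add_one₀ (mul_ne_zero h1 h2), zpow_natCast]
    field_simp
  rw [mul_left_comm, hab]
  generalize U (p : ℤ) = x at *
  generalize U ((p : ℤ) - 1) = y at *
  field_simp
  linear_combination (b * tL * x * y + b * x * (lam - z1 - zn)) * hlam - a * b^2 * tL * hw
end

section
/- Suppose n = 2k with k ≥ 2, z_1 = Δ + iγ and z_n = Δ − iγ with Δ, γ real, t_L = −t_R with t_L t_R real, t_1 > 0, t_2 > 0, and Δ² + γ² − t_L t_R ≤ t_2² ≤ t_1². Then every eigenvalue of H is real. -/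
open Matrix Complex Polynomial

lemma ssh_step (t1 t2 : ℝ) (ht1 : 0 < t1) (ht2 : 0 < t2) (μ A B : ℂ)
    (h : 0 < μ.im * (A * (starRingEnd ℂ) B).im) :
    0 < μ.im * ((-(t2 * A + μ * B) / t1) *
      (starRingEnd ℂ) (A * μ / t1 + B * (μ ^ 2 - t1 ^ 2) / (t1 * t2))).im := by
  have e1 : (-(t2 * A + μ * B) / t1) = ((t1⁻¹ : ℝ) : ℂ) * (-(t2 * A + μ * B)) := by
    push_cast; ring
  have e2 : A * μ / t1 + B * (μ ^ 2 - t1 ^ 2) / (t1 * t2)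
      = (((t1 * t2)⁻¹ : ℝ) : ℂ) * (μ * (t2 * A + μ * B) - t1 ^ 2 * B) := by
    have h1 : (t1 : ℂ) ≠ 0 := by exact_mod_cast ht1.ne'
    have h2 : (t2 : ℂ) ≠ 0 := by exact_mod_cast ht2.ne'
    push_cast; field_simp; ring
  have key : μ.im * (((-(t2 * A + μ * B))) *
      (starRingEnd ℂ) (μ * (t2 * A + μ * B) - t1 ^ 2 * B)).im
      = μ.im ^ 2 * Complex.normSq (t2 * A + μ * B) + t1 ^ 2 * (t2 *
        (μ.im * (A * (starRingEnd ℂ) B).im) + μ.im ^ 2 * Complex.normSq B) := by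
    simp [Complex.normSq_apply, pow_two]
    ring
  have e3 : ((-(t2 * A + μ * B) / t1) *
      (starRingEnd ℂ) (A * μ / t1 + B * (μ ^ 2 - t1 ^ 2) / (t1 * t2)))
      = ((t1⁻¹ * (t1 * t2)⁻¹ : ℝ) : ℂ) * (((-(t2 * A + μ * B))) *
      (starRingEnd ℂ) (μ * (t2 * A + μ * B) - t1 ^ 2 * B)) := by
    rw [e1, e2, map_mul (starRingEnd ℂ), Complex.conj_ofReal, Complex.ofReal_mul]; ring
  rw [e3, Complex.im_ofReal_mul, mul_left_comm, key]
  have n1 := Complex.normSq_nonneg (t2 * A + μ * B)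
  have n2 := Complex.normSq_nonneg B
  positivity

lemma ssh_transfer (t1 t2 : ℝ) (ht1 : 0 < t1) (ht2 : 0 < t2) (μ : ℂ) (hμ : μ.im ≠ 0)
    (φ : ℕ → ℂ) (k : ℕ)
    (h1 : ∀ j < k, t2 * φ (2*j) + t1 * φ (2*j+2) = μ * φ (2*j+1))
    (h2 : ∀ j < k, t1 * φ (2*j+1) + t2 * φ (2*j+3) = μ * φ (2*j+2)) :
    ∀ j, j < k → ∃ A B D : ℂ, 0 < μ.im * (A * (starRingEnd ℂ) B).im ∧
      t2 * μ * (D - A) = B * (μ^2 - t1^2 + t2^2) ∧ A * D + B^2 = 1 ∧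
      φ (2*j+2) = A * φ 0 + B * φ 1 ∧ φ (2*j+3) = -B * φ 0 + D * φ 1 := by
  have c1 : (t1 : ℂ) ≠ 0 := by exact_mod_cast ht1.ne'
  have c2 : (t2 : ℂ) ≠ 0 := by exact_mod_cast ht2.ne'
  have f1 : ∀ j < k, φ (2*j+2) = (μ * φ (2*j+1) - t2 * φ (2*j)) / t1 := by
    intro j hj; rw [eq_div_iff c1]; linear_combination h1 j hj
  have f2 : ∀ j < k, φ (2*j+3) = (μ * φ (2*j+2) - t1 * φ (2*j+1)) / t2 := by
    intro j hj; rw [eq_div_iff c2]; linear_combination h2 j hj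
  intro j
  induction j with
  | zero =>
    intro hj
    refine ⟨-t2/t1, μ/t1, μ^2/(t1*t2) - t1/t2, ?_, ?_, ?_, ?_, ?_⟩
    · have : (-(t2:ℂ)/t1) * (starRingEnd ℂ) (μ/t1) = ((t2/t1^2 : ℝ) : ℂ) * (-(starRingEnd ℂ) μ) := by
        rw [map_div₀, Complex.conj_ofReal]; push_cast; field_simp
      rw [this, Complex.im_ofReal_mul]
      have : 0 < μ.im * μ.im := mul_self_pos.2 hμ
      have : 0 < (t2/t1^2) * (μ.im * μ.im) := by positivity
      simp only [Complex.neg_im, Complex.conj_im]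
      linarith
    · field_simp; ring
    · field_simp; ring
    · rw [f1 0 hj]; field_simp; ring
    · rw [f2 0 hj, f1 0 hj]; field_simp; ring
  | succ j ih =>
    intro hj
    obtain ⟨A, B, D, p, r, d, q1, q2⟩ := ih (by omega)
    refine ⟨_, _, -(μ/t1) * B + D * (μ^2/(t1*t2) - t1/t2), ssh_step t1 t2 ht1 ht2 μ A B p, ?_, ?_, ?_, ?_⟩
    · field_simp
      linear_combination (μ^2 - t1^2) * r
    · have : (t1:ℂ)^2 * t2^2 *(A * D + B^2 - 1) = 0 := by rw [d]; ring
      field_simp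
      have hmu : μ ≠ 0 := by rintro rfl; simp at hμ
      linear_combination (t1^2*t2^2 : ℂ) * d + (-(A * μ * t2 + B * (μ^2-t1^2))) * r
    · rw [f1 (j+1) hj]
      rw [show 2*(j+1)+1 = 2*j+3 by ring, show 2*(j+1) = 2*j+2 by ring, q1, q2]
      field_simp
      linear_combination φ 1 * r
    · rw [f2 (j+1) hj, f1 (j+1) hj]
      rw [show 2*(j+1)+1 = 2*j+3 by ring, show 2*(j+1) = 2*j+2 by ring, q1, q2]
      field_simp
      ring

lemma ssh_final (t1 t2 Δ c : ℝ) (ht1 : 0 < t1) (ht2 : 0 < t2) (hc : c ≤ t2^2) (h12 : t2^2 ≤ t1^2)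
    (μ A B D : ℂ) (hμ : μ.im ≠ 0) (p : 0 < μ.im * (A * (starRingEnd ℂ) B).im)
    (r : t2 * μ * (D - A) = B * (μ^2 - t1^2 + t2^2))
    (e : t2^2 * D - 2 * Δ * t2 * B - c * A = 0) : False := by
  have hmu : μ ≠ 0 := by rintro rfl; simp at hμ
  have hB : B ≠ 0 := by rintro rfl; simp at p
  have hn : 0 < Complex.normSq μ := Complex.normSq_pos.2 hmu
  have hnB : 0 < Complex.normSq B := Complex.normSq_pos.2 hB
  have e' : t2 * D = t2 * A + B * (μ - (t1^2 - t2^2) * μ⁻¹) := by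
    field_simp; linear_combination r
  have E : ((t2^2 - c : ℝ) : ℂ) * (A * (starRingEnd ℂ) B)
      + ((t2 * Complex.normSq B : ℝ) : ℂ) * (μ - ((t1^2 - t2^2 : ℝ) : ℂ) * μ⁻¹)
      - ((2 * Δ * t2 * Complex.normSq B : ℝ) : ℂ) = 0 := by
    push_cast
    rw [← Complex.mul_conj B]
    linear_combination (starRingEnd ℂ) B * e - t2 * (starRingEnd ℂ) B * e'
  have I := congrArg Complex.im E
  simp only [Complex.sub_im, Complex.add_im, Complex.im_ofReal_mul, Complex.ofReal_im,
    Complex.inv_im, Complex.zero_im] at I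
  have I2 : (t2^2 - c) * (μ.im * (A * (starRingEnd ℂ) B).im) + t2 * Complex.normSq B *
      (μ.im^2 + (t1^2 - t2^2) * (μ.im^2 / Complex.normSq μ)) = 0 := by
    linear_combination μ.im * I
  have a1 : 0 ≤ (t2^2 - c) * (μ.im * (A * (starRingEnd ℂ) B).im) :=
    mul_nonneg (by linarith) p.le
  have a2 : 0 ≤ (t1^2 - t2^2) * (μ.im^2 / Complex.normSq μ) :=
    mul_nonneg (by linarith) (by positivity)
  have a3 : 0 < t2 * Complex.normSq B *
      (μ.im^2 + (t1^2 - t2^2) * (μ.im^2 / Complex.normSq μ)) := by positivity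
  linarith

/-- Rows of `Hssh` acting on the extension of a vector by zero. -/
lemma ssh_row (k : ℕ) (hk : 2 ≤ k) (t1 t2 : ℝ) (z1 zn tL tR μ : ℂ) (v : Fin (2*k) → ℂ)
    (hv : Hssh (2*k) t1 t2 z1 zn tL tR *ᵥ v = μ • v) :
    ∃ ψ : ℕ → ℂ, (∀ i : Fin (2*k), ψ i = v i) ∧
      z1 * ψ 0 + t1 * ψ 1 + tL * ψ (2*k-1) = μ * ψ 0 ∧
      tR * ψ 0 + t1 * ψ (2*k-2) + zn * ψ (2*k-1) = μ * ψ (2*k-1) ∧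
      (∀ j, j + 1 < k → t1 * ψ (2*j) + t2 * ψ (2*j+2) = μ * ψ (2*j+1)) ∧
      (∀ j, j + 1 < k → t2 * ψ (2*j+1) + t1 * ψ (2*j+3) = μ * ψ (2*j+2)) := by
  let ψ : ℕ → ℂ := fun i => if h : i < 2*k then v ⟨i, h⟩ else 0
  let g : ℕ → ℕ → ℂ := fun i j =>
    if i = j then (if i = 0 then z1 else if i = 2*k - 1 then zn else 0)
    else if i + 1 = j then (if i % 2 = 0 then (t1 : ℂ) else (t2 : ℂ))
    else if j + 1 = i then (if j % 2 = 0 then (t1 : ℂ) else (t2 : ℂ))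
    else if i = 0 ∧ j = 2*k - 1 then tL
    else if i = 2*k - 1 ∧ j = 0 then tR
    else 0
  have hψ : ∀ i : Fin (2*k), ψ i = v i := by
    intro i; simp [ψ]
  have row : ∀ i < 2*k, ∑ j ∈ Finset.range (2*k), g i j * ψ j = μ * ψ i := by
    intro i hi
    have := congrFun hv ⟨i, hi⟩
    rw [← Fin.sum_univ_eq_sum_range (fun j => g i j * ψ j)]
    simp only [hψ]
    have h3 : ψ i = v ⟨i, hi⟩ := hψ ⟨i, hi⟩
    rw [h3]
    exact this
  have row3 : ∀ a b c i : ℕ, a < 2*k → b < 2*k → c < 2*k → i < 2*k → a ≠ b → a ≠ c → b ≠ c →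
      (∀ j < 2*k, j ≠ a → j ≠ b → j ≠ c → g i j = 0) →
      g i a * ψ a + g i b * ψ b + g i c * ψ c = μ * ψ i := by
    intro a b c i ha hb hc hi hab hac hbc h
    rw [← row i hi]
    have hs : ({a, b, c} : Finset ℕ) ⊆ Finset.range (2*k) := by
      intro j; simp only [Finset.mem_insert, Finset.mem_singleton, Finset.mem_range]; omega
    rw [← Finset.sum_subset hs, Finset.sum_insert (by simp [hab, hac]),
      Finset.sum_insert (by simp [hbc]), Finset.sum_singleton, add_assoc]
    intro j hj hj2
    simp only [Finset.mem_insert, Finset.mem_singleton, not_or, Finset.mem_range] at hj hj2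
    rw [h j hj hj2.1 hj2.2.1 hj2.2.2, zero_mul]
  refine ⟨ψ, hψ, ?_, ?_, ?_, ?_⟩
  · rw [← row3 0 1 (2*k-1) 0 (by omega) (by omega) (by omega) (by omega) (by omega) (by omega)
      (by omega) (by intro j _ _ _ _; grind)]
    have x1 : g 0 0 = z1 := by grind
    have x2 : g 0 1 = t1 := by grind
    have x3 : g 0 (2*k-1) = tL := by grind
    rw [x1, x2, x3]
  · rw [← row3 0 (2*k-2) (2*k-1) (2*k-1) (by omega) (by omega) (by omega) (by omega) (by omega)
      (by omega) (by omega) (by intro j _ _ _ _; grind)]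
    have x1 : g (2*k-1) 0 = tR := by grind
    have x2 : g (2*k-1) (2*k-2) = t1 := by grind
    have x3 : g (2*k-1) (2*k-1) = zn := by grind
    rw [x1, x2, x3]
  · intro j hj
    rw [← row3 (2*j) (2*j+1) (2*j+2) (2*j+1) (by omega) (by omega) (by omega) (by omega) (by omega)
      (by omega) (by omega) (by intro j _ _ _ _; grind)]
    have x1 : g (2*j+1) (2*j) = t1 := by grind
    have x2 : g (2*j+1) (2*j+1) = 0 := by grind
    have x3 : g (2*j+1) (2*j+2) = t2 := by grind
    rw [x1, x2, x3]; ring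
  · intro j hj
    rw [← row3 (2*j+1) (2*j+2) (2*j+3) (2*j+2) (by omega) (by omega) (by omega) (by omega)
      (by omega) (by omega) (by omega) (by intro j _ _ _ _; grind)]
    have x1 : g (2*j+2) (2*j+1) = t2 := by grind
    have x2 : g (2*j+2) (2*j+2) = 0 := by grind
    have x3 : g (2*j+2) (2*j+3) = t1 := by grind
    rw [x1, x2, x3]; ring

theorem stmt18 (n k : ℕ) (t1 t2 : ℝ) (ht1 : 0 < t1) (ht2 : 0 < t2)
    (Δ γ : ℝ) (z1 zn tL tR : ℂ) (hk : 2 ≤ k) (hnk : n = 2*k)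
    (hz1 : z1 = (Δ : ℂ) + Complex.I * (γ : ℂ)) (hzn : zn = (Δ : ℂ) - Complex.I * (γ : ℂ))
    (hLR : tL = -tR) (hLRreal : (tL * tR).im = 0)
    (hineq1 : Δ^2 + γ^2 - (tL * tR).re ≤ t2^2) (hineq2 : t2^2 ≤ t1^2) :
    ∀ μ ∈ spectrum ℂ (Hssh n t1 t2 z1 zn tL tR), μ.im = 0 := by
  intro μ hμ
  by_contra him
  subst hnk
  rw [← Matrix.spectrum_toLin', ← Module.End.hasEigenvalue_iff_mem_spectrum] at hμ
  obtain ⟨v, hv⟩ := hμ.exists_hasEigenvector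
  have hv1 := hv.apply_eq_smul
  rw [Matrix.toLin'_apply] at hv1
  obtain ⟨ψ, hψ, r0, rn, ra, rb⟩ := ssh_row k hk t1 t2 z1 zn tL tR μ v hv1
  have c1 : (t1 : ℂ) ≠ 0 := by exact_mod_cast ht1.ne'
  have c2 : (t2 : ℂ) ≠ 0 := by exact_mod_cast ht2.ne'
  let φ : ℕ → ℂ := fun i => if i = 0 then (z1 * ψ 0 + tL * ψ (2*k-1)) / t2
    else if i = 2*k+1 then (zn * ψ (2*k-1) + tR * ψ 0) / t2 else ψ (i-1)
  have p0 : t2 * φ 0 = z1 * ψ 0 + tL * ψ (2*k-1) := by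
    simp only [φ, if_true]; field_simp
  have pn : t2 * φ (2*k+1) = zn * ψ (2*k-1) + tR * ψ 0 := by
    simp only [φ, if_true]; simp; field_simp
  have pm : ∀ i, i < 2*k → φ (i+1) = ψ i := by
    intro i hi
    simp only [φ]
    rw [if_neg (by omega), if_neg (by omega)]; simp
  have h1 : ∀ j < k, t2 * φ (2*j) + t1 * φ (2*j+2) = μ * φ (2*j+1) := by
    intro j hj
    rw [pm (2*j) (by omega), pm (2*j+1) (by omega)]
    rcases j with _ | j
    · simp only [mul_zero, zero_add]; rw [p0]; linear_combination r0
    · rw [show 2*(j+1) = (2*j+1)+1 by ring, pm (2*j+1) (by omega)]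
      exact rb j hj
  have h2 : ∀ j < k, t1 * φ (2*j+1) + t2 * φ (2*j+3) = μ * φ (2*j+2) := by
    intro j hj
    rw [pm (2*j) (by omega), pm (2*j+1) (by omega)]
    by_cases hjk : j + 1 < k
    · rw [pm (2*j+2) (by omega)]; exact ra j hjk
    · have : k = j + 1 := by omega
      rw [show 2*j+3 = 2*k+1 by omega, pn, show 2*j+1 = 2*k-1 by omega, show 2*j = 2*k-2 by omega]
      linear_combination rn
  have T := ssh_transfer t1 t2 ht1 ht2 μ him φ k h1 h2
  have ne : ¬ (φ 1 = 0 ∧ φ (2*k) = 0) := by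
    rintro ⟨y, p⟩
    have y' : ψ 0 = 0 := by rw [← pm 0 (by omega)]; exact y
    have p' : ψ (2*k-1) = 0 := by
      rw [← pm (2*k-1) (by omega), show 2*k-1+1 = 2*k by omega]; exact p
    have x : φ 0 = 0 := by
      rw [y', p'] at p0; simpa [c2] using p0
    apply hv.2
    funext i
    rw [← hψ i]
    have hi := i.2
    simp only [Pi.zero_apply]
    rcases Nat.eq_zero_or_pos (i:ℕ) with h | h
    · rw [h]; exact y'
    · obtain ⟨A, B, D, -, -, -, q1, q2⟩ := T (((i:ℕ)-1)/2) (by omega)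
      rw [x, y] at q1 q2
      rw [← pm _ hi]
      rcases Nat.even_or_odd' (i:ℕ) with ⟨m, hm | hm⟩
      · rw [show (i:ℕ)+1 = 2*(((i:ℕ)-1)/2)+3 by omega, q2]; ring
      · rw [show (i:ℕ)+1 = 2*(((i:ℕ)-1)/2)+2 by omega, q1]; ring
  obtain ⟨A, B, D, p, r, d, q1, q2⟩ := T (k-1) (by omega)
  rw [show 2*(k-1)+2 = 2*k by omega] at q1
  rw [show 2*(k-1)+3 = 2*k+1 by omega] at q2
  rw [← pm 0 (by omega), ← pm (2*k-1) (by omega), show 2*k-1+1 = 2*k by omega] at p0 pn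
  simp only [zero_add] at p0 pn
  have E1 : (t2 - A * tL) * φ (2*k) = (A * z1 + t2 * B) * φ 1 := by
    linear_combination t2 * q1 + A * p0
  have E2 : (zn + B * tL) * φ (2*k) = (t2 * D - B * z1 - tR) * φ 1 := by
    linear_combination t2 * q2 - B * p0 - pn
  have det : (t2 - A * tL) * (t2 * D - B * z1 - tR) - (A * z1 + t2 * B) * (zn + B * tL) = 0 := by
    by_contra hne
    apply ne
    constructor
    · apply (mul_eq_zero.1 _).resolve_left hne
      linear_combination (zn + B * tL) * E1 - (t2 - A * tL) * E2
    · apply (mul_eq_zero.1 _).resolve_left hne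
      linear_combination (t2 * D - B * z1 - tR) * E1 - (A * z1 + t2 * B) * E2
  have hre : (((tL * tR).re : ℝ) : ℂ) = tL * tR := by
    apply Complex.ext <;> simp only [Complex.ofReal_re, Complex.ofReal_im, hLRreal]
  refine ssh_final t1 t2 Δ (Δ^2 + γ^2 - (tL * tR).re) ht1 ht2 hineq1 hineq2 μ A B D him p r ?_
  rw [Complex.ofReal_sub, hre]
  push_cast
  rw [← det, hz1, hzn, hLR]
  linear_combination (-t2 * tR) * d - A * γ^2 * Complex.I_sq
end
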